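/- (Powers–Størmer inequality) For positive bounded operators B₁, B₂ on a Hilbert space with B₁ - B₂ trace class, ‖√B₁ - √B₂‖²_{HS} ≤ ‖B₁ - B₂‖_tr, where ‖·‖_{HS} is the Hilbert–Schmidt norm and ‖·‖_tr the trace norm. -/

import Mathlib

open scoped ComplexInnerProductSpace
open ContinuousLinearMap

universe u

section PS
variable {H : Type u} [NormedAddCommGroup H] [InnerProductSpace ℂ H] [CompleteSpace H]

lemma ps_compact_aeval (A B : H →L[ℂ] H) (h : IsCompactOperator (A - B))
    (p : Polynomial ℝ) :
    IsCompactOperator (Polynomial.aeval A p - Polynomial.aeval B p : H →L[ℂ] H) := by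
  have hpow : ∀ n : ℕ, IsCompactOperator (A ^ n - B ^ n : H →L[ℂ] H) := by
    intro n
    induction n with
    | zero => simpa using isCompactOperator_zero
    | succ n ih =>
      have e : A ^ (n+1) - B ^ (n+1) = (A ^ n) * (A - B) + (A ^ n - B ^ n) * B := by
        rw [pow_succ, pow_succ]; noncomm_ring
      rw [e]
      exact IsCompactOperator.add (f := ⇑((A ^ n) * (A - B))) (g := ⇑((A ^ n - B ^ n) * B))
        (h.clm_comp (A ^ n)) (ih.comp_clm B)
  induction p using Polynomial.induction_on' with
  | add p q hp hq =>
    rw [map_add, map_add, add_sub_add_comm]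
    exact hp.add hq
  | monomial n a =>
    rw [Polynomial.aeval_monomial, Polynomial.aeval_monomial, ← Algebra.smul_def,
      ← Algebra.smul_def, ← smul_sub]
    exact (hpow n).smul a

lemma ps_root_approx (R : H →L[ℂ] H) (hR : R.IsPositive) (C : ℝ) (hC : ‖R‖ ≤ C) (ε : ℝ)
    (hε : 0 < ε) (p : Polynomial ℝ)
    (hp : ∀ x ∈ Set.Icc (0:ℝ) (C ^ 2), |p.eval x - Real.sqrt x| < ε) :
    ‖R - Polynomial.aeval (R * R) p‖ ≤ ε := by
  have hR0 : 0 ≤ R := (nonneg_iff_isPositive R).2 hR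
  have hsa : IsSelfAdjoint R := hR.isSelfAdjoint
  have e : R - Polynomial.aeval (R * R) p
      = Polynomial.aeval R (Polynomial.X - p.comp (Polynomial.X ^ 2)) := by
    simp [Polynomial.aeval_comp, pow_two]
  rw [e, ← cfc_polynomial (R := ℝ) _ R hsa]
  apply norm_cfc_le hε.le
  intro x hx
  have hx0 : 0 ≤ x := spectrum_nonneg_of_nonneg hR0 hx
  have hx1 : x ≤ C := by
    have := spectrum.norm_le_norm_mul_of_mem hx
    have h1 : ‖(1 : H →L[ℂ] H)‖ ≤ 1 := ContinuousLinearMap.norm_id_le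
    have h2 : x ≤ ‖x‖ := Real.le_norm_self x
    nlinarith [norm_nonneg R]
  have := hp (x ^ 2) ⟨by positivity, by gcongr⟩
  rw [Real.sqrt_sq hx0] at this
  simp only [Polynomial.eval_sub, Polynomial.eval_X, Polynomial.eval_comp, Polynomial.eval_pow]
  rw [Real.norm_eq_abs, abs_sub_comm]
  exact this.le

lemma ps_compact_root (R S : H →L[ℂ] H) (hR : R.IsPositive) (hS : S.IsPositive)
    (h : IsCompactOperator (R * R - S * S : H →L[ℂ] H)) :
    IsCompactOperator (R - S : H →L[ℂ] H) := by
  have hcl := isClosed_setOfPred_isCompactOperator (σ₁₂ := RingHom.id ℂ) (M₁ := H) (M₂ := H)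
  change (R - S) ∈ {f : H →L[ℂ] H | IsCompactOperator f}
  rw [← hcl.closure_eq, Metric.mem_closure_iff]
  intro ε hε
  obtain ⟨p, hp⟩ := exists_polynomial_near_of_continuousOn 0 ((max ‖R‖ ‖S‖) ^ 2) Real.sqrt
    Real.continuous_sqrt.continuousOn (ε / 3) (by positivity)
  refine ⟨_, ps_compact_aeval _ _ h p, ?_⟩
  have h1 := ps_root_approx R hR _ (le_max_left _ ‖S‖) _ (by positivity) p hp
  have h2 := ps_root_approx S hS _ (le_max_right ‖R‖ _) _ (by positivity) p hp
  rw [dist_eq_norm, sub_sub_sub_comm]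
  have := norm_sub_le (R - Polynomial.aeval (R * R) p) (S - Polynomial.aeval (S * S) p)
  linarith

lemma ps_parseval {ι : Type*} (b : HilbertBasis ι ℂ H) (x : H) :
    HasSum (fun i => ‖⟪b i, x⟫‖ ^ 2) (‖x‖ ^ 2) := by
  have := (b.hasSum_inner_mul_inner x x).mapL Complex.reCLM
  simp only [Complex.reCLM_apply] at this
  convert this using 1
  · ext i
    rw [← inner_conj_symm x (b i), mul_comm, Complex.mul_conj, Complex.ofReal_re, Complex.normSq_eq_norm_sq]
  · exact (inner_self_eq_norm_sq (𝕜 := ℂ) x).symm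

lemma ps_hs_compact {ι : Type*} (b : HilbertBasis ι ℂ H) (A : H →L[ℂ] H) (hA : IsSelfAdjoint A)
    (hs : Summable fun i => ‖A (b i)‖ ^ 2) : IsCompactOperator A := by
  classical
  have hcl := isClosed_setOfPred_isCompactOperator (σ₁₂ := RingHom.id ℂ) (M₁ := H) (M₂ := H)
  change A ∈ {f : H →L[ℂ] H | IsCompactOperator f}
  rw [← hcl.closure_eq, Metric.mem_closure_iff]
  intro ε hε
  obtain ⟨F, hF⟩ := (hs.hasSum.eventually_const_lt
    (show (∑' i, ‖A (b i)‖ ^ 2) - (ε/2) ^ 2 < ∑' i, ‖A (b i)‖ ^ 2 by linarith [pow_pos (half_pos hε) 2])).exists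
  let K : H →L[ℂ] H := ∑ i ∈ F, (innerSL ℂ (A (b i))).smulRight (b i)
  refine ⟨K, ?_, ?_⟩
  · change K ∈ compactOperator (RingHom.id ℂ) H H
    apply Submodule.sum_mem
    intro i _
    exact (isCompactOperator_of_locallyCompactSpace_rng
      ((ContinuousLinearMap.id ℂ ℂ).smulRight (b i))).comp_clm (innerSL ℂ (A (b i)))
  · rw [dist_eq_norm]
    apply lt_of_le_of_lt _ (half_lt_self hε)
    apply ContinuousLinearMap.opNorm_le_bound _ (by positivity)
    intro x
    have h1 := ps_parseval b ((A - K) x)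
    have h2 : HasSum (fun j => (‖A (b j)‖ ^ 2 - if j ∈ F then ‖A (b j)‖ ^ 2 else 0) * ‖x‖ ^ 2)
        (((∑' i, ‖A (b i)‖ ^ 2) - ∑ i ∈ F, ‖A (b i)‖ ^ 2) * ‖x‖ ^ 2) := by
      apply HasSum.mul_right
      apply hs.hasSum.sub
      have := hasSum_sum_of_ne_finset_zero (s := F) (L := SummationFilter.unconditional ι)
        (f := fun j => if j ∈ F then ‖A (b j)‖ ^ 2 else 0) (by intro j hj; simp [hj])
      rwa [Finset.sum_congr rfl (fun i hi => if_pos hi)] at this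
    have h3 := hasSum_le (fun j => ?_) h1 h2
    · have : ‖(A - K) x‖ ^ 2 ≤ (ε / 2 * ‖x‖) ^ 2 := by
        rw [mul_pow]
        refine h3.trans ?_
        gcongr
        linarith
      exact le_of_sq_le_sq this (by positivity)
    · have e : ⟪b j, A x⟫ = ⟪A (b j), x⟫ := by
        rw [← ContinuousLinearMap.adjoint_inner_left, ← ContinuousLinearMap.star_eq_adjoint,
          hA.star_eq]
      have e2 : ⟪b j, (A - K) x⟫ = if j ∈ F then 0 else ⟪A (b j), x⟫ := by
        simp only [K, sub_apply, inner_sub_right, e, _root_.sum_apply, inner_sum,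
          ContinuousLinearMap.smulRight_apply, inner_smul_right, innerSL_apply_apply,
          orthonormal_iff_ite.1 b.orthonormal]
        by_cases hj : j ∈ F <;> simp [hj]
      rw [e2]
      by_cases hj : j ∈ F
      · simp [hj]
      · simp only [hj, if_false, sub_zero]
        rw [← mul_pow]
        gcongr
        exact norm_inner_le_norm _ _

lemma ps_parseval_enn {ι : Type*} (b : HilbertBasis ι ℂ H) (x : H) :
    ENNReal.ofReal (‖x‖ ^ 2) = ∑' k, ENNReal.ofReal (‖⟪b k, x⟫‖ ^ 2) := by
  have := ps_parseval b x
  rw [← this.tsum_eq, ENNReal.ofReal_tsum_of_nonneg (fun _ => by positivity) this.summable]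

lemma ps_hs_indep {ι κ : Type*} (b : HilbertBasis ι ℂ H) (e : HilbertBasis κ ℂ H)
    (A : H →L[ℂ] H) (hA : IsSelfAdjoint A) :
    ∑' i, ENNReal.ofReal (‖A (b i)‖ ^ 2) = ∑' k, ENNReal.ofReal (‖A (e k)‖ ^ 2) := by
  simp_rw [fun i => ps_parseval_enn e (A (b i)), fun k => ps_parseval_enn b (A (e k))]
  rw [ENNReal.tsum_comm]
  refine tsum_congr fun k => tsum_congr fun i => ?_
  rw [← inner_conj_symm, RCLike.norm_conj, ← hA.isSymmetric.apply_clm (b i) (e k)]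

lemma ps_eigenbasis (S : H →L[ℂ] H) (hS : IsSelfAdjoint S) (hc : IsCompactOperator S) :
    ∃ (κ : Type u) (e : HilbertBasis κ ℂ H) (l : κ → ℂ), ∀ k, S (e k) = l k • e k := by
  have hsym : S.IsSymmetric := hS.isSymmetric
  have hbot := orthogonalComplement_iSup_eigenspaces_eq_bot hc hsym
  have hex : ∀ μ : ℂ, ∃ (w : Set (Module.End.eigenspace (S : Module.End ℂ H) μ))
      (b : HilbertBasis w ℂ (Module.End.eigenspace (S : Module.End ℂ H) μ)),
      ⇑b = ((↑) : w → _) := by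
    intro μ
    have : IsClosed ((Module.End.eigenspace (S : Module.End ℂ H) μ : Submodule ℂ H) : Set H) := by
      have : ((Module.End.eigenspace (S : Module.End ℂ H) μ : Submodule ℂ H) : Set H)
          = {x | S x = μ • x} := by
        ext x; simp [Module.End.mem_eigenspace_iff]
      rw [this]
      exact isClosed_eq S.continuous (continuous_const_smul μ)
    have := this.completeSpace_coe
    exact exists_hilbertBasis _ _
  choose w v hv using hex
  have hon := hsym.orthogonalFamily_eigenspaces.orthonormal_sigma_orthonormal
    (v_family := fun μ => v μ) (fun μ => (v μ).orthonormal)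
  refine ⟨(Σ μ, w μ), HilbertBasis.mkOfOrthogonalEqBot hon ?_, fun a => a.1, ?_⟩
  · rw [eq_bot_iff, ← hbot]
    intro x hx
    rw [← Submodule.iInf_orthogonal, Submodule.mem_iInf]
    intro μ
    rw [Submodule.mem_orthogonal']
    intro y hy
    have h1 := (((v μ).hasSum_repr ⟨y, hy⟩).mapL
      (Submodule.subtypeL (Module.End.eigenspace (S : Module.End ℂ H) μ))).mapL (innerSL ℂ x)
    refine h1.unique ?_
    refine Eq.subst (motive := fun f : w μ → ℂ => HasSum f 0) (Eq.symm (funext fun i => ?_))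
      (hasSum_zero : HasSum (fun _ : w μ => (0 : ℂ)) 0)
    have h2 : ⟪x, ((v μ i : Module.End.eigenspace (S : Module.End ℂ H) μ) : H)⟫ = 0 :=
      (Submodule.mem_orthogonal' _ _).1 hx _ (Submodule.subset_span ⟨⟨μ, i⟩, rfl⟩)
    simp [inner_smul_right, h2]
  · intro k
    simp only [HilbertBasis.coe_mkOfOrthogonalEqBot]
    exact Module.End.mem_eigenspace_iff.1 (v k.1 k.2).2

lemma ps_abs (D M : H →L[ℂ] H) (hD : IsSelfAdjoint D) (hM : M.IsPositive) (h : M * M = D * D)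
    (x : H) : |(⟪x, D x⟫).re| ≤ (⟪x, M x⟫).re := by
  have hM0 : 0 ≤ M := (nonneg_iff_isPositive M).2 hM
  have hMe : CFC.abs D = M := by
    unfold CFC.abs
    rw [hD.star_eq]
    exact CFC.sqrt_unique h hM0
  have h1 := CFC.abs_sub_self D hD
  have h2 := CFC.abs_add_self D hD
  rw [hMe] at h1 h2
  have p1 : (M - D).IsPositive := by
    rw [← nonneg_iff_isPositive, h1]
    exact nsmul_nonneg (CFC.negPart_nonneg D) 2
  have p2 : (M + D).IsPositive := by
    rw [← nonneg_iff_isPositive, h2]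
    exact nsmul_nonneg (CFC.posPart_nonneg D) 2
  have q1 := p1.re_inner_nonneg_right x
  have q2 := p2.re_inner_nonneg_right x
  simp only [sub_apply, add_apply, inner_sub_right, inner_add_right, map_sub, map_add,
    RCLike.re_eq_complex_re] at q1 q2
  rw [abs_le]
  constructor <;> linarith

lemma ps_pos_tr (M : H →L[ℂ] H) (hM : M.IsPositive) :
    ∃ N : H →L[ℂ] H, N.IsPositive ∧ N * N = M ∧ ∀ x, (⟪x, M x⟫).re = ‖N x‖ ^ 2 := by
  have hM0 : 0 ≤ M := (nonneg_iff_isPositive M).2 hM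
  have hN : (CFC.sqrt M).IsPositive := (nonneg_iff_isPositive _).1 (CFC.sqrt_nonneg M)
  have hNN := CFC.sqrt_mul_sqrt_self M hM0
  refine ⟨CFC.sqrt M, hN, hNN, fun x => ?_⟩
  nth_rewrite 1 [← hNN]
  rw [mul_apply_eq_comp, ← hN.isSelfAdjoint.isSymmetric.apply_clm]
  exact inner_self_eq_norm_sq (𝕜 := ℂ) _

lemma ps_eigen_ineq (R₁ R₂ : H →L[ℂ] H) (hR₁ : R₁.IsPositive) (hR₂ : R₂.IsPositive)
    (x : H) (hx : ‖x‖ = 1) (l : ℂ) (hl : (R₁ - R₂) x = l • x) :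
    ‖(R₁ - R₂) x‖ ^ 2 ≤ |(⟪x, (R₁ * R₁ - R₂ * R₂) x⟫).re| := by
  have hs1 := hR₁.isSelfAdjoint.isSymmetric
  have hs2 := hR₂.isSelfAdjoint.isSymmetric
  have ha := hR₁.re_inner_nonneg_right x
  have hc := hR₂.re_inner_nonneg_right x
  have hai : (⟪x, R₁ x⟫).im = 0 := by
    have := hs1.apply_clm x x
    rw [← inner_conj_symm] at this
    exact Complex.conj_eq_iff_im.1 this
  have hci : (⟪x, R₂ x⟫).im = 0 := by
    have := hs2.apply_clm x x
    rw [← inner_conj_symm] at this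
    exact Complex.conj_eq_iff_im.1 this
  simp only [RCLike.re_eq_complex_re] at ha hc
  have hl' : ⟪x, R₁ x⟫ - ⟪x, R₂ x⟫ = l := by
    rw [← inner_sub_right, ← sub_apply, hl, inner_smul_right, inner_self_eq_norm_sq_to_K, hx]
    simp
  have hlim : l.im = 0 := by rw [← hl']; simp [hai, hci]
  have hlre : l.re = (⟪x, R₁ x⟫).re - (⟪x, R₂ x⟫).re := by rw [← hl']; simp
  have e1 : ⟪x, (R₁ * R₁ - R₂ * R₂) x⟫ = l * (⟪x, R₁ x⟫ + ⟪x, R₂ x⟫)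
      + (⟪x, R₁ (R₂ x)⟫ - ⟪x, R₂ (R₁ x)⟫) := by
    have e2 : R₁ x = l • x + R₂ x := by rw [← hl]; simp
    have e3 : R₁ (R₁ x) = l • R₁ x + R₁ (R₂ x) := by
      conv_lhs => rw [e2]
      simp
    have e4 : R₂ (R₁ x) = l • R₂ x + R₂ (R₂ x) := by
      conv_lhs => rw [e2]
      simp
    rw [sub_apply, mul_apply_eq_comp, mul_apply_eq_comp, inner_sub_right, e3, e4]
    simp only [inner_add_right, inner_smul_right]
    ring
  have e5 : (⟪x, R₁ (R₂ x)⟫ - ⟪x, R₂ (R₁ x)⟫).re = 0 := by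
    have : ⟪x, R₂ (R₁ x)⟫ = starRingEnd ℂ ⟪x, R₁ (R₂ x)⟫ := by
      rw [inner_conj_symm, hs1.apply_clm, hs2.apply_clm]
    rw [this, Complex.sub_re, Complex.conj_re, sub_self]
  rw [e1, Complex.add_re, e5, Complex.mul_re, hlim, Complex.add_re, zero_mul, sub_zero, add_zero,
    hl, norm_smul, hx, mul_one, Complex.sq_norm, Complex.normSq_apply, hlim, mul_zero, add_zero,
    abs_mul, ← abs_mul_abs_self l.re]
  refine mul_le_mul_of_nonneg_left ?_ (abs_nonneg _)
  rw [hlre, abs_of_nonneg (add_nonneg ha hc), abs_le]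
  constructor <;> linarith
end PS

theorem stmt_2 {H : Type*} [NormedAddCommGroup H] [InnerProductSpace ℂ H] [CompleteSpace H]
    {ι : Type*} (b : HilbertBasis ι ℂ H)
    (B₁ B₂ R₁ R₂ M : H →L[ℂ] H)
    (hB₁ : B₁.IsPositive) (hB₂ : B₂.IsPositive)
    (hR₁ : R₁.IsPositive) (hR₁sq : R₁ ∘L R₁ = B₁)
    (hR₂ : R₂.IsPositive) (hR₂sq : R₂ ∘L R₂ = B₂)
    (hM : M.IsPositive) (hMsq : M ∘L M = (B₁ - B₂) ∘L (B₁ - B₂))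
    (htr : Summable fun i => (⟪b i, M (b i)⟫).re) :
    (∑' i, ENNReal.ofReal (‖(R₁ - R₂) (b i)‖ ^ 2)) ≤
      ∑' i, ENNReal.ofReal ((⟪b i, M (b i)⟫).re) := by
  obtain ⟨N, hN, hNN, hNx⟩ := ps_pos_tr M hM
  have hD : IsSelfAdjoint (B₁ - B₂) := hB₁.isSelfAdjoint.sub hB₂.isSelfAdjoint
  have hnorm : ∀ x, ‖(B₁ - B₂) x‖ ^ 2 = ‖M x‖ ^ 2 := by
    intro x
    have e := congrArg (fun T : H →L[ℂ] H => ⟪x, T x⟫) hMsq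
    simp only [ContinuousLinearMap.comp_apply] at e
    rw [← hM.isSelfAdjoint.isSymmetric.apply_clm, ← hD.isSymmetric.apply_clm] at e
    have := congrArg Complex.re e
    rw [← inner_self_eq_norm_sq (𝕜 := ℂ), ← inner_self_eq_norm_sq (𝕜 := ℂ)]
    exact this.symm
  have hDs : Summable fun i => ‖(B₁ - B₂) (b i)‖ ^ 2 := by
    refine Summable.of_nonneg_of_le (fun _ => by positivity) (fun i => ?_) (htr.mul_left (‖N‖ ^ 2))
    rw [hnorm, hNx, ← mul_pow, ← hNN]
    gcongr
    exact N.le_opNorm _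
  have hDc := ps_hs_compact b _ hD hDs
  have hS : IsSelfAdjoint (R₁ - R₂) := hR₁.isSelfAdjoint.sub hR₂.isSelfAdjoint
  have hDe : B₁ - B₂ = R₁ * R₁ - R₂ * R₂ := by rw [← hR₁sq, ← hR₂sq]; rfl
  have hSc : IsCompactOperator (R₁ - R₂) := ps_compact_root R₁ R₂ hR₁ hR₂ (hDe ▸ hDc)
  obtain ⟨κ, e, l, hl⟩ := ps_eigenbasis (R₁ - R₂) hS hSc
  rw [ps_hs_indep b e _ hS]
  simp_rw [hNx]
  rw [ps_hs_indep b e _ hN.isSelfAdjoint]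
  refine ENNReal.tsum_le_tsum fun k => ENNReal.ofReal_le_ofReal ?_
  rw [← hNx]
  refine (ps_eigen_ineq R₁ R₂ hR₁ hR₂ _ (e.orthonormal.1 k) _ (hl k)).trans ?_
  rw [← hDe]
  exact ps_abs _ M hD hM hMsq _
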